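/- In the ring R = Z_6[γ]/(γ^6 − 1), the 6×6 matrix M with rows (1,1,1,1,1,1), (0,1,2,3,4,5), (0,1,4,9,16,25), (1,γ,γ²,γ³,γ⁴,γ⁵), (0,γ,2γ²,3γ³,4γ⁴,5γ⁵), (0,γ,4γ²,9γ³,16γ⁴,25γ⁵) has determinant 4γ³(γ−1)⁹ = 4 + 2γ³, which is nonzero in R. -/

import Mathlib

open Polynomial

set_option maxHeartbeats 4000000 in
theorem det_aux {S : Type*} [CommRing S] (g : S) :
    (!![1, 1, 1, 1, 1, 1;
         0, 1, 2, 3, 4, 5;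
         0, 1, 4, 9, 16, 25;
         1, g, g ^ 2, g ^ 3, g ^ 4, g ^ 5;
         0, g, 2 * g ^ 2, 3 * g ^ 3, 4 * g ^ 4, 5 * g ^ 5;
         0, g, 4 * g ^ 2, 9 * g ^ 3, 16 * g ^ 4, 25 * g ^ 5] : Matrix (Fin 6) (Fin 6) S).det = 4 * g ^ 3 * (g - 1) ^ 9 := by
  simp [Matrix.det_succ_row_zero, Fin.sum_univ_succ, Fin.succAbove]
  ring

theorem reduce_aux {S : Type*} [CommRing S] (g : S) (h6 : (6 : S) = 0) (hg : g ^ 6 = 1) :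
    4 * g ^ 3 * (g - 1) ^ 9 = 4 + 2 * g ^ 3 := by
  linear_combination 4 * (g ^ 6 + 1) * hg + (-g ^ 3 + g ^ 3 * (-6 * g ^ 8 + 24 * g ^ 7 - 56 * g ^ 6
    + 84 * g ^ 5 - 84 * g ^ 4 + 56 * g ^ 3 - 24 * g ^ 2 + 6 * g)) * h6

/-- In `R = ℤ_6[γ]/(γ^6 − 1)`, the 6×6 interpolation matrix (values and
first and second weighted derivatives at `T = 1` and `T = γ`) has determinant
`4γ³(γ−1)⁹ = 4 + 2γ³`, which is nonzero in `R`. -/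
theorem stmt_7 :
    let R := AdjoinRoot (X ^ 6 - 1 : (ZMod 6)[X])
    let γ : R := AdjoinRoot.root _
    let M : Matrix (Fin 6) (Fin 6) R :=
      !![1, 1, 1, 1, 1, 1;
         0, 1, 2, 3, 4, 5;
         0, 1, 4, 9, 16, 25;
         1, γ, γ ^ 2, γ ^ 3, γ ^ 4, γ ^ 5;
         0, γ, 2 * γ ^ 2, 3 * γ ^ 3, 4 * γ ^ 4, 5 * γ ^ 5;
         0, γ, 4 * γ ^ 2, 9 * γ ^ 3, 16 * γ ^ 4, 25 * γ ^ 5]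
    M.det = 4 * γ ^ 3 * (γ - 1) ^ 9 ∧
    M.det = 4 + 2 * γ ^ 3 ∧
    M.det ≠ 0 := by
  intro R γ M
  have h6 : (6 : R) = 0 := by
    have h : (6 : ZMod 6) = 0 := by decide
    have := congrArg (algebraMap (ZMod 6) R) h
    rwa [map_ofNat, map_zero] at this
  have hg : γ ^ 6 = 1 := by
    have h := AdjoinRoot.eval₂_root (X ^ 6 - 1 : (ZMod 6)[X])
    simp only [eval₂_sub, eval₂_pow, eval₂_X, eval₂_one] at h
    exact sub_eq_zero.mp h
  have h1 : M.det = 4 * γ ^ 3 * (γ - 1) ^ 9 := det_aux γ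
  have h2 : M.det = 4 + 2 * γ ^ 3 := h1.trans (reduce_aux γ h6 hg)
  refine ⟨h1, h2, ?_⟩
  rw [h2]
  intro h0
  let f : R →+* ZMod 6 := AdjoinRoot.lift (RingHom.id (ZMod 6)) (-1) (by
    simp only [eval₂_sub, eval₂_pow, eval₂_X, eval₂_one]; decide)
  have hf : f γ = -1 := AdjoinRoot.lift_root _
  have h := congrArg f h0
  rw [map_add, map_mul, map_pow, hf, map_ofNat, map_ofNat, map_zero] at h
  exact absurd h (by decide)
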